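/- arXiv:2502.03064 — 4 statements merged into one kernel-verified Lean document; each statement's English description precedes it below -/
import Mathlib

section
/- Let I₁ ⊆ ℝ be an open interval, let f₁, f₂ : I₁ → ℝ be smooth nowhere-zero functions, and set h₁ := f₁'/f₁, h₂ := f₂'/f₂. Then the equation h₁(x)h₂(x) + h₂'(x) − h₂(x)² = 0 holds for all x ∈ I₁ if and only if either f₂ is constant, or f₂ = k₂/(F − c₂) where F is any fixed antiderivative of 1/f₁ on I₁, k₂ ∈ ℝ \ {0}, and c₂ ∈ ℝ \ F(I₁). -/
/-- The derivative of `f g' / g²`, as a multiple of `h₁h₂ + h₂' - h₂²` with `h₁ = f'/f` and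
`h₂ = g'/g`. -/
theorem hasDerivAt_mul_logDeriv_div {f g : ℝ → ℝ} {x : ℝ} (hf : DifferentiableAt ℝ f x)
    (hg : DifferentiableAt ℝ g x) (hg' : DifferentiableAt ℝ (deriv g) x)
    (hfx : f x ≠ 0) (hgx : g x ≠ 0) :
    HasDerivAt (fun y => f y * (deriv g y / g y) / g y)
      (f x / g x * (deriv f x / f x * (deriv g x / g x) + deriv (fun y => deriv g y / g y) x
        - (deriv g x / g x) ^ 2)) x := by
  have h := (hf.hasDerivAt.mul (hg'.div hg hgx).hasDerivAt).div hg.hasDerivAt hgx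
  refine h.congr_deriv ?_
  simp only [Pi.div_def, Pi.mul_apply]
  field_simp

/-- A function with vanishing derivative on an open order-connected set is constant there. -/
theorem exists_eq_const_of_hasDerivAt_zero {s : Set ℝ} (hs : IsOpen s) (hc : s.OrdConnected)
    {f : ℝ → ℝ} (hf : ∀ x ∈ s, HasDerivAt f 0 x) : ∃ c, ∀ x ∈ s, f x = c :=
  hs.exists_is_const_of_deriv_eq_zero hc.isPreconnected
    (fun x hx => (hf x hx).differentiableAt.differentiableWithinAt) fun x hx => (hf x hx).deriv

/-- The equation `h₁h₂ + h₂' - h₂² = 0` says that `1 / g` is an affine function of an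
antiderivative of `1 / f`. -/
theorem logDeriv_equation_iff_inv_affine {s : Set ℝ} (hs : IsOpen s) (hc : s.OrdConnected)
    {f g F : ℝ → ℝ} (hf : ∀ x ∈ s, DifferentiableAt ℝ f x) (hg : ∀ x ∈ s, DifferentiableAt ℝ g x)
    (hg' : ∀ x ∈ s, DifferentiableAt ℝ (deriv g) x)
    (hfne : ∀ x ∈ s, f x ≠ 0) (hgne : ∀ x ∈ s, g x ≠ 0)
    (hF : ∀ x ∈ s, HasDerivAt F (1 / f x) x) :
    (∀ x ∈ s, deriv f x / f x * (deriv g x / g x) + deriv (fun y => deriv g y / g y) x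
        - (deriv g x / g x) ^ 2 = 0) ↔
      ∃ a b : ℝ, ∀ x ∈ s, (g x)⁻¹ = a + b * F x := by
  have hG x (hx : x ∈ s) := hasDerivAt_mul_logDeriv_div (hf x hx) (hg x hx) (hg' x hx)
    (hfne x hx) (hgne x hx)
  constructor
  · intro h
    obtain ⟨c, hcG⟩ := exists_eq_const_of_hasDerivAt_zero hs hc fun x hx =>
      (hG x hx).congr_deriv (by rw [h x hx, mul_zero])
    obtain ⟨d, hd⟩ := exists_eq_const_of_hasDerivAt_zero hs hc
      (f := fun x => (g x)⁻¹ + c * F x) fun x hx => by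
        refine (((hg x hx).hasDerivAt.fun_inv (hgne x hx)).fun_add
          ((hF x hx).const_mul c)).congr_deriv ?_
        have hfx := hfne x hx
        have hgx := hgne x hx
        rw [← hcG x hx]
        field_simp
        ring
    exact ⟨d, -c, fun x hx => by linear_combination hd x hx⟩
  · rintro ⟨a, b, h⟩ x hx
    have hcG : ∀ y ∈ s, f y * (deriv g y / g y) / g y = -b := fun y hy => by
      have hfy := hfne y hy
      have hgy := hgne y hy
      have h₁ := (hg y hy).hasDerivAt.fun_inv hgy
      have h₂ := (((hF y hy).const_mul b).const_add a).congr_of_eventuallyEq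
        (Filter.eventuallyEq_of_mem (hs.mem_nhds hy) h)
      have h₃ := h₁.unique h₂
      field_simp at h₃ ⊢
      linear_combination -h₃
    have h₀ := (hasDerivAt_const x (-b)).congr_of_eventuallyEq
      (Filter.eventuallyEq_of_mem (hs.mem_nhds hx) hcG)
    exact (mul_eq_zero.mp ((hG x hx).unique h₀)).resolve_left
      (div_ne_zero (hfne x hx) (hgne x hx))

/-- Theorem 2.7 of the paper, in analytic form: for smooth nowhere-zero `f₁, f₂ : I₁ → ℝ` with
`hᵢ = fᵢ'/fᵢ`, the equation `h₁h₂ + h₂' - h₂² = 0` holds on `I₁` iff `f₂` is constant or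
`f₂ = k₂/(F - c₂)` where `F` is an antiderivative of `1/f₁` on `I₁`, `k₂ ≠ 0`,
`c₂ ∉ F(I₁)`. -/
theorem stmt_8 (I₁ : Set ℝ)
    (hI₁open : IsOpen I₁) (hI₁conn : I₁.OrdConnected) (hI₁ne : I₁.Nonempty)
    (f₁ f₂ : ℝ → ℝ)
    (hf₁smooth : ContDiffOn ℝ (⊤ : ℕ∞) f₁ I₁) (hf₁ne : ∀ x ∈ I₁, f₁ x ≠ 0)
    (hf₂smooth : ContDiffOn ℝ (⊤ : ℕ∞) f₂ I₁) (hf₂ne : ∀ x ∈ I₁, f₂ x ≠ 0)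
    (h₁ h₂ : ℝ → ℝ)
    (hh₁ : h₁ = fun x => deriv f₁ x / f₁ x)
    (hh₂ : h₂ = fun x => deriv f₂ x / f₂ x)
    (F : ℝ → ℝ) (hF : ∀ x ∈ I₁, HasDerivAt F (1 / f₁ x) x) :
    (∀ x ∈ I₁, h₁ x * h₂ x + deriv h₂ x - (h₂ x) ^ 2 = 0) ↔
      (∃ k₂ : ℝ, ∀ x ∈ I₁, f₂ x = k₂) ∨
      (∃ k₂ : ℝ, k₂ ≠ 0 ∧ ∃ c₂ : ℝ, (∀ x ∈ I₁, F x ≠ c₂) ∧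
        ∀ x ∈ I₁, f₂ x = k₂ / (F x - c₂)) := by
  subst hh₁ hh₂
  have hd₁ : ∀ x ∈ I₁, DifferentiableAt ℝ f₁ x := fun x hx =>
    (hf₁smooth.differentiableOn (by simp)).differentiableAt (hI₁open.mem_nhds hx)
  have hd₂ : ∀ x ∈ I₁, DifferentiableAt ℝ f₂ x := fun x hx =>
    (hf₂smooth.differentiableOn (by simp)).differentiableAt (hI₁open.mem_nhds hx)
  have hd₂' : ∀ x ∈ I₁, DifferentiableAt ℝ (deriv f₂) x := fun x hx =>
    ((hf₂smooth.deriv_of_isOpen (m := (⊤ : ℕ∞)) hI₁open le_rfl).differentiableOn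
      (by simp)).differentiableAt (hI₁open.mem_nhds hx)
  refine (logDeriv_equation_iff_inv_affine hI₁open hI₁conn hd₁ hd₂ hd₂' hf₁ne hf₂ne hF).trans ?_
  constructor
  · rintro ⟨a, b, h⟩
    by_cases hb : b = 0
    · exact Or.inl ⟨a⁻¹, fun x hx => by rw [← inv_inv (f₂ x), h x hx, hb, zero_mul, add_zero]⟩
    · have hfac : ∀ x, a + b * F x = b * (F x - -a / b) := fun x => by field_simp; ring
      refine Or.inr ⟨b⁻¹, inv_ne_zero hb, -a / b, fun x hx hFx => ?_, fun x hx => ?_⟩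
      · apply inv_ne_zero (hf₂ne x hx)
        rw [h x hx, hfac, hFx, sub_self, mul_zero]
      · rw [← inv_inv (f₂ x), h x hx, hfac, mul_inv, ← div_eq_mul_inv]
  · rintro (⟨k, h⟩ | ⟨k, -, c, -, h⟩)
    · exact ⟨k⁻¹, 0, fun x hx => by rw [h x hx, zero_mul, add_zero]⟩
    · exact ⟨-c / k, k⁻¹, fun x hx => by rw [h x hx, inv_div]; ring⟩
end

section
/- Let I₁, I₃ ⊆ ℝ be open intervals, let f₁, f₂ : I₃ → ℝ and f₃ : I₁ → ℝ be smooth nowhere-zero functions, and set h₁ := f₁'/f₁, h₂ := f₂'/f₂, h₃ := f₃'/f₃. Then the system { f₁(x³)²(h₃'(x¹) − h₃(x¹)²) + f₃(x¹)²(h₁'(x³) − h₁(x³)²) = 0 for all (x¹, x³) ∈ I₁ × I₃, h₂'(x³) = h₂(x³)² for all x³ ∈ I₃, h₁(x³)h₂(x³) = 0 for all x³ ∈ I₃, and h₂(x³)h₃(x¹) = 0 for all x³ ∈ I₃ and x¹ ∈ I₁ } holds if and only if either (a) f₁ and f₃ are constant, and f₂ is constant or f₂(x³) = k₂/(x³ −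 c₂) with k₂ ∈ ℝ \ {0} and c₂ ∈ ℝ \ I₃; or (b) f₂ is constant and there exists k ∈ ℝ such that f₁f₁'' − 2(f₁')² = k·f₁⁴ on I₃ and f₃f₃'' − 2(f₃')² = −k·f₃⁴ on I₁. -/
/-- For twice differentiable nonvanishing `f` and `h = f'/f`, one has
`h' - h² = (f f'' - 2 (f')²) / f²`. -/
lemma deriv_logDeriv_sub_sq {f : ℝ → ℝ} {x : ℝ} (hf : DifferentiableAt ℝ f x)
    (hf' : DifferentiableAt ℝ (deriv f) x) (hx : f x ≠ 0) :
    deriv (fun y => deriv f y / f y) x - (deriv f x / f x) ^ 2 =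
      (f x * deriv (deriv f) x - 2 * deriv f x ^ 2) / f x ^ 2 := by
  rw [deriv_fun_div hf' hf hx]
  field_simp
  ring

lemma ContDiffOn.differentiableAt_and_deriv {I : Set ℝ} (hI : IsOpen I) {f : ℝ → ℝ}
    (hf : ContDiffOn ℝ (⊤ : ℕ∞) f I) {x : ℝ} (hx : x ∈ I) :
    DifferentiableAt ℝ f x ∧ DifferentiableAt ℝ (deriv f) x := by
  have h2 : ContDiffOn ℝ 2 f I := contDiffOn_infty.1 hf 2
  refine ⟨(h2.differentiableOn (by norm_num)).differentiableAt (hI.mem_nhds hx), ?_⟩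
  have h1 : ContDiffOn ℝ 1 (deriv f) I := h2.deriv_of_isOpen hI (by norm_num)
  exact (h1.differentiableOn (by norm_num)).differentiableAt (hI.mem_nhds hx)

lemma deriv_eq_zero_of_eq_const {I : Set ℝ} (hI : IsOpen I) {f : ℝ → ℝ} {k : ℝ}
    (hf : ∀ x ∈ I, f x = k) {x : ℝ} (hx : x ∈ I) : deriv f x = 0 := by
  have : f =ᶠ[nhds x] fun _ => k := Filter.eventually_of_mem (hI.mem_nhds hx) hf
  rw [this.deriv_eq, deriv_const]

lemma deriv_logDeriv_eq_zero_of_eq_const {I : Set ℝ} (hI : IsOpen I) {f : ℝ → ℝ} {k : ℝ}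
    (hf : ∀ x ∈ I, f x = k) {x : ℝ} (hx : x ∈ I) :
    deriv (fun y => deriv f y / f y) x = 0 :=
  deriv_eq_zero_of_eq_const hI (k := 0)
    (fun y hy => by rw [deriv_eq_zero_of_eq_const hI hf hy, zero_div]) hx

lemma deriv_div_sub_const {I : Set ℝ} (hI : IsOpen I) {f : ℝ → ℝ} {k c : ℝ} (hcI : c ∉ I)
    (hf : ∀ x ∈ I, f x = k / (x - c)) {x : ℝ} (hx : x ∈ I) :
    deriv f x = -k / (x - c) ^ 2 := by
  have hxc : x - c ≠ 0 := sub_ne_zero.2 fun h => hcI (h ▸ hx)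
  have : f =ᶠ[nhds x] fun y => k / (y - c) := Filter.eventually_of_mem (hI.mem_nhds hx) hf
  rw [this.deriv_eq]
  have := (hasDerivAt_const x k).fun_div ((hasDerivAt_id' x).sub_const c) hxc
  rw [this.deriv]
  ring

lemma deriv_logDeriv_of_eq_div_sub {I : Set ℝ} (hI : IsOpen I) {f : ℝ → ℝ} {k c : ℝ}
    (hk : k ≠ 0) (hcI : c ∉ I) (hf : ∀ x ∈ I, f x = k / (x - c)) {x : ℝ} (hx : x ∈ I) :
    deriv (fun y => deriv f y / f y) x = (deriv f x / f x) ^ 2 := by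
  have hlog : ∀ y ∈ I, deriv f y / f y = -1 / (y - c) := fun y hy => by
    have hyc : y - c ≠ 0 := sub_ne_zero.2 fun h => hcI (h ▸ hy)
    rw [deriv_div_sub_const hI hcI hf hy, hf y hy]
    field_simp
  rw [deriv_div_sub_const (f := fun y => deriv f y / f y) hI hcI hlog hx, hlog x hx, div_pow]
  ring

/-- If `f` is nonvanishing with `f f'' = 2 (f')²` on an open interval, then `1/f` is affine there. -/
lemma exists_inv_eq_affine {I : Set ℝ} (hI : IsOpen I) (hc : I.OrdConnected) {f : ℝ → ℝ}
    (hf : ContDiffOn ℝ (⊤ : ℕ∞) f I) (hne : ∀ x ∈ I, f x ≠ 0)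
    (h : ∀ x ∈ I, f x * deriv (deriv f) x - 2 * deriv f x ^ 2 = 0) :
    ∃ a b : ℝ, ∀ x ∈ I, (f x)⁻¹ = a * x + b ∧ deriv f x = -a * f x ^ 2 := by
  have hder : ∀ x ∈ I, HasDerivAt (fun y => -deriv f y / f y ^ 2) 0 x := fun x hx => by
    obtain ⟨d1, d2⟩ := hf.differentiableAt_and_deriv hI hx
    have hx0 := hne x hx
    refine (d2.hasDerivAt.fun_neg.fun_div (d1.hasDerivAt.fun_pow 2)
      (pow_ne_zero 2 hx0)).congr_deriv ?_
    rw [div_eq_iff (by positivity)]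
    push_cast
    linear_combination -f x * h x hx
  obtain ⟨a, ha⟩ := hI.exists_is_const_of_deriv_eq_zero hc.isPreconnected
    (fun x hx => (hder x hx).differentiableAt.differentiableWithinAt)
    fun x hx => (hder x hx).deriv
  have hder' : ∀ x ∈ I, HasDerivAt (fun y => (f y)⁻¹ - a * y) 0 x := fun x hx => by
    obtain ⟨d1, -⟩ := hf.differentiableAt_and_deriv hI hx
    refine ((d1.hasDerivAt.fun_inv (hne x hx)).fun_sub
      ((hasDerivAt_id' x).const_mul a)).congr_deriv ?_
    rw [ha x hx]
    ring
  obtain ⟨b, hb⟩ := hI.exists_is_const_of_deriv_eq_zero hc.isPreconnected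
    (fun x hx => (hder' x hx).differentiableAt.differentiableWithinAt)
    fun x hx => (hder' x hx).deriv
  refine ⟨a, b, fun x hx => ⟨by linarith [hb x hx], ?_⟩⟩
  have := ha x hx
  rw [div_eq_iff (pow_ne_zero 2 (hne x hx))] at this
  linarith


/-- Analytic core of Theorem 2.8 of the paper: for smooth nowhere-zero `f₁, f₂ : I₃ → ℝ` and
`f₃ : I₁ → ℝ` with `hᵢ = fᵢ'/fᵢ`, the flatness system holds iff either (a) `f₁, f₃` are
constant and `f₂` is constant or of the form `k₂/(x³ - c₂)` with `c₂ ∉ I₃`, or (b) `f₂` is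
constant and there is `k ∈ ℝ` with `f₁f₁'' - 2(f₁')² = k f₁⁴` on `I₃` and
`f₃f₃'' - 2(f₃')² = -k f₃⁴` on `I₁`. -/
theorem stmt_12 (I₁ I₃ : Set ℝ)
    (hI₁open : IsOpen I₁) (hI₁conn : I₁.OrdConnected) (hI₁ne : I₁.Nonempty)
    (hI₃open : IsOpen I₃) (hI₃conn : I₃.OrdConnected) (hI₃ne : I₃.Nonempty)
    (f₁ f₂ f₃ : ℝ → ℝ)
    (hf₁smooth : ContDiffOn ℝ (⊤ : ℕ∞) f₁ I₃) (hf₁ne : ∀ x ∈ I₃, f₁ x ≠ 0)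
    (hf₂smooth : ContDiffOn ℝ (⊤ : ℕ∞) f₂ I₃) (hf₂ne : ∀ x ∈ I₃, f₂ x ≠ 0)
    (hf₃smooth : ContDiffOn ℝ (⊤ : ℕ∞) f₃ I₁) (hf₃ne : ∀ x ∈ I₁, f₃ x ≠ 0)
    (h₁ h₂ h₃ : ℝ → ℝ)
    (hh₁ : h₁ = fun x => deriv f₁ x / f₁ x)
    (hh₂ : h₂ = fun x => deriv f₂ x / f₂ x)
    (hh₃ : h₃ = fun x => deriv f₃ x / f₃ x) :
    ((∀ x1 ∈ I₁, ∀ x3 ∈ I₃,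
        (f₁ x3) ^ 2 * (deriv h₃ x1 - (h₃ x1) ^ 2) +
          (f₃ x1) ^ 2 * (deriv h₁ x3 - (h₁ x3) ^ 2) = 0) ∧
      (∀ x3 ∈ I₃, deriv h₂ x3 = (h₂ x3) ^ 2) ∧
      (∀ x3 ∈ I₃, h₁ x3 * h₂ x3 = 0) ∧
      (∀ x3 ∈ I₃, ∀ x1 ∈ I₁, h₂ x3 * h₃ x1 = 0)) ↔
      ((∃ k₁ : ℝ, ∀ x ∈ I₃, f₁ x = k₁) ∧ (∃ k₃ : ℝ, ∀ x ∈ I₁, f₃ x = k₃) ∧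
        ((∃ k₂ : ℝ, ∀ x ∈ I₃, f₂ x = k₂) ∨
          ∃ k₂ : ℝ, k₂ ≠ 0 ∧ ∃ c₂ : ℝ, c₂ ∉ I₃ ∧ ∀ x ∈ I₃, f₂ x = k₂ / (x - c₂))) ∨
      ((∃ k₂ : ℝ, ∀ x ∈ I₃, f₂ x = k₂) ∧
        ∃ k : ℝ,
          (∀ x ∈ I₃,
            f₁ x * deriv (deriv f₁) x - 2 * (deriv f₁ x) ^ 2 = k * (f₁ x) ^ 4) ∧
          (∀ x ∈ I₁,
            f₃ x * deriv (deriv f₃) x - 2 * (deriv f₃ x) ^ 2 = -k * (f₃ x) ^ 4)) := by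
  subst hh₁ hh₂ hh₃
  have key : ∀ {I : Set ℝ} {f : ℝ → ℝ}, IsOpen I → ContDiffOn ℝ (⊤ : ℕ∞) f I →
      (∀ x ∈ I, f x ≠ 0) → ∀ x ∈ I, deriv (fun y => deriv f y / f y) x - (deriv f x / f x) ^ 2 =
        (f x * deriv (deriv f) x - 2 * deriv f x ^ 2) / f x ^ 2 := fun hI hf hne x hx =>
    deriv_logDeriv_sub_sq (hf.differentiableAt_and_deriv hI hx).1
      (hf.differentiableAt_and_deriv hI hx).2 (hne x hx)
  have const : ∀ {I : Set ℝ} {f : ℝ → ℝ}, IsOpen I → I.OrdConnected →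
      ContDiffOn ℝ (⊤ : ℕ∞) f I → (∀ x ∈ I, deriv f x = 0) → ∃ k : ℝ, ∀ x ∈ I, f x = k :=
    fun hI hc hf h0 => hI.exists_is_const_of_deriv_eq_zero hc.isPreconnected
      (hf.differentiableOn (by simp)) h0
  have key₁ := key hI₃open hf₁smooth hf₁ne
  have key₂ := key hI₃open hf₂smooth hf₂ne
  have key₃ := key hI₁open hf₃smooth hf₃ne
  constructor
  · rintro ⟨hsys, hricc, h12, h23⟩
    obtain ⟨a, b, hab⟩ := exists_inv_eq_affine hI₃open hI₃conn hf₂smooth hf₂ne fun x hx => by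
      have h := key₂ x hx
      rw [sub_eq_zero.2 (hricc x hx), eq_comm, div_eq_zero_iff] at h
      exact h.resolve_right (pow_ne_zero 2 (hf₂ne x hx))
    by_cases ha : a = 0
    · right
      refine ⟨const hI₃open hI₃conn hf₂smooth fun x hx => by simp [(hab x hx).2, ha], ?_⟩
      have hmain : ∀ x1 ∈ I₁, ∀ x3 ∈ I₃,
          (f₃ x1 * deriv (deriv f₃) x1 - 2 * deriv f₃ x1 ^ 2) * f₁ x3 ^ 4 =
            -(f₁ x3 * deriv (deriv f₁) x3 - 2 * deriv f₁ x3 ^ 2) * f₃ x1 ^ 4 := by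
        intro x1 hx1 x3 hx3
        have h := hsys x1 hx1 x3 hx3
        beta_reduce at h
        rw [key₁ x3 hx3, key₃ x1 hx1] at h
        have n1 := hf₁ne x3 hx3
        have n3 := hf₃ne x1 hx1
        field_simp at h
        linear_combination h
      obtain ⟨p, hp⟩ := hI₁ne
      obtain ⟨q, hq⟩ := hI₃ne
      have np := hf₃ne p hp
      have nq := hf₁ne q hq
      refine ⟨(f₁ q * deriv (deriv f₁) q - 2 * deriv f₁ q ^ 2) / f₁ q ^ 4, fun x hx => ?_,
        fun x hx => ?_⟩
      · have e1 := hmain p hp q hq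
        have e2 := hmain p hp x hx
        rw [div_mul_eq_mul_div, eq_div_iff (pow_ne_zero 4 nq)]
        apply mul_right_cancel₀ (pow_ne_zero 4 np)
        linear_combination f₁ q ^ 4 * e2 - f₁ x ^ 4 * e1
      · rw [← neg_div, div_mul_eq_mul_div, eq_div_iff (pow_ne_zero 4 nq)]
        exact hmain x hx q hq
    · left
      have hlog : ∀ x ∈ I₃, deriv f₂ x / f₂ x ≠ 0 := fun x hx => by
        rw [(hab x hx).2]
        exact div_ne_zero (mul_ne_zero (neg_ne_zero.2 ha) (pow_ne_zero 2 (hf₂ne x hx)))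
          (hf₂ne x hx)
      refine ⟨const hI₃open hI₃conn hf₁smooth fun x hx => ?_,
        const hI₁open hI₁conn hf₃smooth fun x hx => ?_,
        Or.inr ⟨a⁻¹, inv_ne_zero ha, -b / a, ?_, ?_⟩⟩
      · have h := (mul_eq_zero.1 (h12 x hx)).resolve_right (hlog x hx)
        exact (div_eq_zero_iff.1 h).resolve_right (hf₁ne x hx)
      · obtain ⟨q, hq⟩ := hI₃ne
        have h := (mul_eq_zero.1 (h23 q hq x hx)).resolve_left (hlog q hq)
        exact (div_eq_zero_iff.1 h).resolve_right (hf₃ne x hx)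
      · intro hmem
        apply inv_ne_zero (hf₂ne _ hmem)
        rw [(hab _ hmem).1]
        field_simp
        ring
      · intro x hx
        rw [← inv_inv (f₂ x), (hab x hx).1, inv_eq_one_div a, div_div, one_div]
        congr 1
        field_simp
        ring
  · rintro (⟨⟨k₁, c1⟩, ⟨k₃, c3⟩, c2⟩ | ⟨⟨k₂, c2⟩, k, e1, e3⟩)
    · refine ⟨fun x1 hx1 x3 hx3 => ?_, fun x hx => ?_, fun x hx => ?_, fun x hx y hy => ?_⟩
      · simp [deriv_logDeriv_eq_zero_of_eq_const hI₃open c1 hx3,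
          deriv_logDeriv_eq_zero_of_eq_const hI₁open c3 hx1,
          deriv_eq_zero_of_eq_const hI₃open c1 hx3, deriv_eq_zero_of_eq_const hI₁open c3 hx1]
      · rcases c2 with ⟨k₂, c2⟩ | ⟨k₂, hk₂, c, hc, c2⟩
        · simp [deriv_logDeriv_eq_zero_of_eq_const hI₃open c2 hx,
            deriv_eq_zero_of_eq_const hI₃open c2 hx]
        · exact deriv_logDeriv_of_eq_div_sub hI₃open hk₂ hc c2 hx
      · simp [deriv_eq_zero_of_eq_const hI₃open c1 hx]
      · simp [deriv_eq_zero_of_eq_const hI₁open c3 hy]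
    · refine ⟨fun x1 hx1 x3 hx3 => ?_, fun x hx => ?_, fun x hx => ?_, fun x hx y hy => ?_⟩
      · beta_reduce
        rw [key₁ x3 hx3, key₃ x1 hx1, e1 x3 hx3, e3 x1 hx1]
        have n1 := hf₁ne x3 hx3
        have n3 := hf₃ne x1 hx1
        field_simp
        ring
      · simp [deriv_logDeriv_eq_zero_of_eq_const hI₃open c2 hx,
          deriv_eq_zero_of_eq_const hI₃open c2 hx]
      · simp [deriv_eq_zero_of_eq_const hI₃open c2 hx]
      · simp [deriv_eq_zero_of_eq_const hI₃open c2 hx]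
end

section
/- Let f₂ : ℝ → ℝ and f₃ : ℝ² → ℝ be smooth nowhere-zero functions, and define a₂₁ := f₂'/f₂, a₃₁ := (∂₁f₃)/f₃, a₃₂ := f₂·(∂₂f₃)/f₃. If the system { a₂₁' = a₂₁² on ℝ; ∂₁a₃₁ = a₃₁², f₂·∂₂a₃₂ − a₃₂² = a₂₁a₃₁, and ∂₁a₃₂ = a₃₁a₃₂ on ℝ² } holds, then f₂ and f₃ are both constant. -/
/-- A nowhere-zero function on `ℝ` with constant derivative is constant. -/
theorem derivative_eq_zero_of_hasDerivAt_const {h : ℝ → ℝ} {m : ℝ} (hne : ∀ x, h x ≠ 0)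
    (hd : ∀ x, HasDerivAt h m x) : m = 0 := by
  have hsub : ∀ x, HasDerivAt (fun t => h t - m * t) 0 x := fun x => by
    simpa using (hd x).fun_sub ((hasDerivAt_id' x).const_mul m)
  have hconst := is_const_of_deriv_eq_zero (fun x => (hsub x).differentiableAt)
    (fun x => (hsub x).deriv)
  by_contra hm
  refine hne (-h 0 / m) ?_
  have h0 := hconst (-h 0 / m) 0
  have hmul : m * (-h 0 / m) = -h 0 := by field_simp
  simp only [hmul, mul_zero] at h0
  linarith

/-- If the logarithmic derivative `u` of a nowhere-zero `C²` function on `ℝ` satisfies the Riccati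
equation `u' = u²`, then the function is constant: its inverse has vanishing second derivative. -/
theorem eq_of_deriv_logDeriv_eq_sq {g : ℝ → ℝ} (hg : ContDiff ℝ 2 g) (hne : ∀ x, g x ≠ 0)
    (hric : ∀ x, deriv (fun t => deriv g t / g t) x = (deriv g x / g x) ^ 2) (x y : ℝ) :
    g x = g y := by
  have hg1 : Differentiable ℝ g := hg.differentiable (by norm_num)
  have hg2 : Differentiable ℝ (deriv g) :=
    (hg.deriv' (n := 1)).differentiable (by norm_num)
  have hlog : ∀ x, HasDerivAt (fun t => deriv g t / g t) ((deriv g x / g x) ^ 2) x := fun x => by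
    rw [← hric x]
    exact ((hg2 x).div (hg1 x) (hne x)).hasDerivAt
  have hinv' : ∀ x, HasDerivAt (fun t => -(deriv g t / g t / g t)) 0 x := fun x => by
    refine ((hlog x).fun_div (hg1 x).hasDerivAt (hne x)).fun_neg.congr_deriv ?_
    have := hne x
    field_simp
    ring
  have hconst := is_const_of_deriv_eq_zero (fun x => (hinv' x).differentiableAt)
    (fun x => (hinv' x).deriv)
  have hinv : ∀ x, HasDerivAt (fun t => (g t)⁻¹) (-(deriv g 0 / g 0 / g 0)) x := fun x => by
    rw [hconst 0 x]
    refine ((hg1 x).hasDerivAt.fun_inv (hne x)).congr_deriv ?_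
    have := hne x
    field_simp
  have hzero := derivative_eq_zero_of_hasDerivAt_const (fun x => inv_ne_zero (hne x)) hinv
  rw [hzero] at hinv
  exact inv_injective (is_const_of_deriv_eq_zero (fun x => (hinv x).differentiableAt)
    (fun x => (hinv x).deriv) x y)


/-- Corollary 3.10 of the paper, in analytic form: if smooth nowhere-zero `f₂ : ℝ → ℝ` and
`f₃ : ℝ² → ℝ` satisfy the flatness system of the sequential warped product on all of `ℝ`
(resp. `ℝ²`), then `f₂` and `f₃` are both constant. -/
theorem stmt_18 (f₂ : ℝ → ℝ) (f₃ : ℝ → ℝ → ℝ)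
    (hf₂smooth : ContDiff ℝ (⊤ : ℕ∞) f₂) (hf₂ne : ∀ x : ℝ, f₂ x ≠ 0)
    (hf₃smooth : ContDiff ℝ (⊤ : ℕ∞) (Function.uncurry f₃))
    (hf₃ne : ∀ x y : ℝ, f₃ x y ≠ 0)
    (a₂₁ : ℝ → ℝ) (ha₂₁ : a₂₁ = fun x => deriv f₂ x / f₂ x)
    (a₃₁ a₃₂ : ℝ → ℝ → ℝ)
    (ha₃₁ : a₃₁ = fun x y => deriv (fun t => f₃ t y) x / f₃ x y)
    (ha₃₂ : a₃₂ = fun x y => f₂ x * deriv (fun t => f₃ x t) y / f₃ x y)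
    (hsys1 : ∀ x : ℝ, deriv a₂₁ x = (a₂₁ x) ^ 2)
    (hsys2 : ∀ x y : ℝ,
        deriv (fun t => a₃₁ t y) x = (a₃₁ x y) ^ 2 ∧
        f₂ x * deriv (fun t => a₃₂ x t) y - (a₃₂ x y) ^ 2 = a₂₁ x * a₃₁ x y ∧
        deriv (fun t => a₃₂ t y) x = a₃₁ x y * a₃₂ x y) :
    (∃ k₂ : ℝ, ∀ x : ℝ, f₂ x = k₂) ∧ (∃ k₃ : ℝ, ∀ x y : ℝ, f₃ x y = k₃) := by
  have htwo : ((2 : ℕ∞) : WithTop ℕ∞) ≤ ((⊤ : ℕ∞) : WithTop ℕ∞) := by exact_mod_cast le_top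
  subst ha₂₁ ha₃₁ ha₃₂
  have hf₂ := eq_of_deriv_logDeriv_eq_sq (hf₂smooth.of_le htwo) hf₂ne hsys1
  have hf₃ : ContDiff ℝ 2 (Function.uncurry f₃) := hf₃smooth.of_le htwo
  have hfst : ∀ x x' y, f₃ x y = f₃ x' y := fun x x' y =>
    eq_of_deriv_logDeriv_eq_sq (g := fun t => f₃ t y)
      (hf₃.comp (contDiff_id.prodMk contDiff_const)) (fun t => hf₃ne t y)
      (fun t => (hsys2 t y).1) x x'
  have hsnd : ∀ x y y', f₃ x y = f₃ x y' := fun x y y' => by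
    refine eq_of_deriv_logDeriv_eq_sq (g := fun t => f₃ x t)
      (hf₃.comp (contDiff_const.prodMk contDiff_id)) (fun t => hf₃ne x t) (fun t => ?_) y y'
    have hd₂ : deriv f₂ x = 0 := by
      rw [show f₂ = fun _ => f₂ 0 from funext fun s => hf₂ s 0, deriv_const]
    have heq := (hsys2 x t).2.1
    simp only [mul_div_assoc, deriv_const_mul_field, hd₂, zero_div, zero_mul] at heq
    refine mul_left_cancel₀ (pow_ne_zero 2 (hf₂ne x)) ?_
    linear_combination heq
  exact ⟨⟨f₂ 0, fun x => hf₂ x 0⟩,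
    ⟨f₃ 0 0, fun x y => (hfst x 0 y).trans (hsnd 0 y 0)⟩⟩
end

section
/- Let I₁, I₂, I₃ ⊆ ℝ be open intervals, let f : I₃ → ℝ and f₃ : I₁ × I₂ → ℝ be smooth nowhere-zero functions. Then the system { f'(x³) = 0 for all x³ ∈ I₃; and ∂₁((∂₁f₃)/f₃) = ((∂₁f₃)/f₃)², ∂₂((∂₂f₃)/f₃) = ((∂₂f₃)/f₃)², ∂₁((∂₂f₃)/f₃) = ((∂₁f₃)/f₃)·((∂₂f₃)/f₃) on I₁ × I₂ } holds if and only if f is constant and there exist c₁, c₂, c₃ ∈ ℝ with c₁x¹ + c₂x² + c₃ ≠ 0 for all (x¹, x²) ∈ I₁ × I₂ such that f₃(x¹, x²) = 1/(c₁x¹ + c₂x² + c₃). -/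
/-- A function with vanishing derivative on an open order-connected set is constant there. -/
theorem eq_of_hasDerivAt_zero {I : Set ℝ} (hI : IsOpen I) (hc : I.OrdConnected) {g : ℝ → ℝ}
    (h : ∀ x ∈ I, HasDerivAt g 0 x) {x y : ℝ} (hx : x ∈ I) (hy : y ∈ I) : g x = g y :=
  hI.is_const_of_deriv_eq_zero hc.isPreconnected
    (fun z hz => (h z hz).differentiableAt.differentiableWithinAt)
    (fun z hz => (h z hz).deriv) hx hy

/-- The partial derivatives of a smooth function of two real variables on an open set are
themselves smooth. -/
theorem contDiffOn_partial_derivs {U : Set (ℝ × ℝ)} (hU : IsOpen U) {F : ℝ → ℝ → ℝ}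
    (hF : ContDiffOn ℝ (⊤ : ℕ∞) (Function.uncurry F) U) :
    ContDiffOn ℝ (⊤ : ℕ∞) (fun p : ℝ × ℝ => deriv (fun t => F t p.2) p.1) U ∧
      ContDiffOn ℝ (⊤ : ℕ∞) (fun p : ℝ × ℝ => deriv (fun t => F p.1 t) p.2) U := by
  have hD : ContDiffOn ℝ (⊤ : ℕ∞) (fderiv ℝ (Function.uncurry F)) U :=
    hF.fderiv_of_isOpen hU (by simp)
  have hd : ∀ p ∈ U, HasFDerivAt (Function.uncurry F) (fderiv ℝ (Function.uncurry F) p) p :=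
    fun p hp => ((hF.contDiffAt (hU.mem_nhds hp)).differentiableAt (by simp)).hasFDerivAt
  refine ⟨(hD.clm_apply (contDiffOn_const (c := ((1 : ℝ), (0 : ℝ))))).congr fun p hp => ?_,
    (hD.clm_apply (contDiffOn_const (c := ((0 : ℝ), (1 : ℝ))))).congr fun p hp => ?_⟩
  · exact ((hd p hp).comp_hasDerivAt p.1
      ((hasDerivAt_id p.1).prodMk (hasDerivAt_const p.1 p.2))).deriv
  · exact ((hd p hp).comp_hasDerivAt p.2
      ((hasDerivAt_const p.2 p.1).prodMk (hasDerivAt_id p.2))).deriv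

/-- A smooth function of two variables on an open set is differentiable in each variable. -/
theorem ContDiffOn.differentiableAt_partial {U : Set (ℝ × ℝ)} (hU : IsOpen U) {F : ℝ → ℝ → ℝ}
    (hF : ContDiffOn ℝ (⊤ : ℕ∞) (Function.uncurry F) U) {x y : ℝ} (h : (x, y) ∈ U) :
    DifferentiableAt ℝ (fun t => F t y) x ∧ DifferentiableAt ℝ (fun t => F x t) y := by
  have hd : DifferentiableAt ℝ (Function.uncurry F) (x, y) :=
    (hF.contDiffAt (hU.mem_nhds h)).differentiableAt (by simp)
  exact ⟨hd.comp (f := fun t : ℝ => (t, y)) x (by fun_prop),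
    hd.comp (f := fun t : ℝ => (x, t)) y (by fun_prop)⟩

/-- If the logarithmic derivative of `u` is `a` and `m` satisfies `m' = a m`, then `m / u` has
vanishing derivative. -/
theorem hasDerivAt_div_zero {u m : ℝ → ℝ} {x : ℝ} (hu : DifferentiableAt ℝ u x) (hux : u x ≠ 0)
    (hm : DifferentiableAt ℝ m x) (h : deriv m x = deriv u x / u x * m x) :
    HasDerivAt (fun t => m t / u t) 0 x := by
  refine (hm.hasDerivAt.div hu.hasDerivAt hux).congr_deriv ?_
  rw [h]
  field_simp
  ring

/-- If `u'/u² = a` at `x`, then `1/u + a t` has vanishing derivative there. -/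
theorem hasDerivAt_inv_add_mul_zero {u : ℝ → ℝ} {x a : ℝ} (hu : DifferentiableAt ℝ u x)
    (hux : u x ≠ 0) (h : deriv u x / u x / u x = a) :
    HasDerivAt (fun t => (u t)⁻¹ + a * t) 0 x := by
  refine ((hu.hasDerivAt.inv hux).add ((hasDerivAt_id x).const_mul a)).congr_deriv ?_
  rw [← h]
  field_simp
  ring

/-- Derivative of `k / L` for an affine function `L` of one variable. -/
theorem hasDerivAt_div_affine (k c d x : ℝ) (h : c * x + d ≠ 0) :
    HasDerivAt (fun t => k / (c * t + d)) (-(k * c) / (c * x + d) ^ 2) x := by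
  refine ((hasDerivAt_const x k).div
    (((hasDerivAt_id x).const_mul c).add_const d) h).congr_deriv ?_
  simp

/-- Theorem 3.11 of the paper, in analytic form: for smooth nowhere-zero `f : I₃ → ℝ` and
`f₃ : I₁ × I₂ → ℝ`, the flatness system of the doubly warped product (namely `f' = 0` on `I₃`
together with the PDE system `∂₁(∂₁f₃/f₃) = (∂₁f₃/f₃)²`, `∂₂(∂₂f₃/f₃) = (∂₂f₃/f₃)²`,
`∂₁(∂₂f₃/f₃) = (∂₁f₃/f₃)(∂₂f₃/f₃)` on `I₁ × I₂`) holds iff `f` is constant and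
`f₃(x¹,x²) = 1/(c₁x¹ + c₂x² + c₃)` with nowhere-vanishing denominator. -/
theorem stmt_19 (I₁ I₂ I₃ : Set ℝ)
    (hI₁open : IsOpen I₁) (hI₁conn : I₁.OrdConnected) (hI₁ne : I₁.Nonempty)
    (hI₂open : IsOpen I₂) (hI₂conn : I₂.OrdConnected) (hI₂ne : I₂.Nonempty)
    (hI₃open : IsOpen I₃) (hI₃conn : I₃.OrdConnected) (hI₃ne : I₃.Nonempty)
    (f : ℝ → ℝ) (f₃ : ℝ → ℝ → ℝ)
    (hfsmooth : ContDiffOn ℝ (⊤ : ℕ∞) f I₃) (hfne : ∀ x ∈ I₃, f x ≠ 0)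
    (hf₃smooth : ContDiffOn ℝ (⊤ : ℕ∞) (Function.uncurry f₃) (I₁ ×ˢ I₂))
    (hf₃ne : ∀ x ∈ I₁, ∀ y ∈ I₂, f₃ x y ≠ 0)
    (l₁ l₂ : ℝ → ℝ → ℝ)
    (hl₁ : l₁ = fun x y => deriv (fun t => f₃ t y) x / f₃ x y)
    (hl₂ : l₂ = fun x y => deriv (fun t => f₃ x t) y / f₃ x y) :
    ((∀ z ∈ I₃, deriv f z = 0) ∧
      (∀ x ∈ I₁, ∀ y ∈ I₂,
        deriv (fun t => l₁ t y) x = (l₁ x y) ^ 2 ∧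
        deriv (fun t => l₂ x t) y = (l₂ x y) ^ 2 ∧
        deriv (fun t => l₂ t y) x = l₁ x y * l₂ x y)) ↔
      (∃ k : ℝ, ∀ z ∈ I₃, f z = k) ∧
      ∃ c₁ c₂ c₃ : ℝ,
        (∀ x ∈ I₁, ∀ y ∈ I₂, c₁ * x + c₂ * y + c₃ ≠ 0) ∧
        (∀ x ∈ I₁, ∀ y ∈ I₂, f₃ x y = 1 / (c₁ * x + c₂ * y + c₃)) := by
  have hU : IsOpen (I₁ ×ˢ I₂) := hI₁open.prod hI₂open
  obtain ⟨x₀, hx₀⟩ := hI₁ne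
  obtain ⟨y₀, hy₀⟩ := hI₂ne
  obtain ⟨z₀, hz₀⟩ := hI₃ne
  have hf3 : ∀ x ∈ I₁, ∀ y ∈ I₂,
      DifferentiableAt ℝ (fun t => f₃ t y) x ∧ DifferentiableAt ℝ (fun t => f₃ x t) y :=
    fun x hx y hy => hf₃smooth.differentiableAt_partial hU ⟨hx, hy⟩
  constructor
  · rintro ⟨hf, hpde⟩
    have hf3ne : ∀ p ∈ I₁ ×ˢ I₂, Function.uncurry f₃ p ≠ 0 := fun p hp => hf₃ne _ hp.1 _ hp.2
    have hl₁d : ContDiffOn ℝ (⊤ : ℕ∞) (Function.uncurry l₁) (I₁ ×ˢ I₂) := by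
      rw [hl₁]
      exact (contDiffOn_partial_derivs hU hf₃smooth).1.div hf₃smooth hf3ne
    have hl₂d : ContDiffOn ℝ (⊤ : ℕ∞) (Function.uncurry l₂) (I₁ ×ˢ I₂) := by
      rw [hl₂]
      exact (contDiffOn_partial_derivs hU hf₃smooth).2.div hf₃smooth hf3ne
    have e₁ : ∀ x y, deriv (fun t => f₃ t y) x / f₃ x y = l₁ x y := fun x y => by rw [hl₁]
    have e₂ : ∀ x y, deriv (fun t => f₃ x t) y / f₃ x y = l₂ x y := fun x y => by rw [hl₂]
    refine ⟨⟨f z₀, fun z hz => eq_of_hasDerivAt_zero hI₃open hI₃conn (fun w hw => ?_) hz hz₀⟩, ?_⟩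
    · rw [← hf w hw]
      exact ((hfsmooth.contDiffAt (hI₃open.mem_nhds hw)).differentiableAt (by simp)).hasDerivAt
    have hP : ∀ x ∈ I₁, l₁ x y₀ / f₃ x y₀ = l₁ x₀ y₀ / f₃ x₀ y₀ := fun x hx =>
      eq_of_hasDerivAt_zero (g := fun t => l₁ t y₀ / f₃ t y₀) hI₁open hI₁conn (fun w hw =>
        hasDerivAt_div_zero (hf3 w hw y₀ hy₀).1 (hf₃ne w hw y₀ hy₀)
          (hl₁d.differentiableAt_partial hU ⟨hw, hy₀⟩).1
          (by rw [(hpde w hw y₀ hy₀).1, e₁, sq])) hx hx₀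
    have hQ₁ : ∀ x ∈ I₁, ∀ y ∈ I₂, l₂ x y / f₃ x y = l₂ x₀ y / f₃ x₀ y := fun x hx y hy =>
      eq_of_hasDerivAt_zero (g := fun t => l₂ t y / f₃ t y) hI₁open hI₁conn (fun w hw =>
        hasDerivAt_div_zero (hf3 w hw y hy).1 (hf₃ne w hw y hy)
          (hl₂d.differentiableAt_partial hU ⟨hw, hy⟩).1
          (by rw [(hpde w hw y hy).2.2, e₁])) hx hx₀
    have hQ₂ : ∀ y ∈ I₂, l₂ x₀ y / f₃ x₀ y = l₂ x₀ y₀ / f₃ x₀ y₀ := fun y hy =>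
      eq_of_hasDerivAt_zero (g := fun t => l₂ x₀ t / f₃ x₀ t) hI₂open hI₂conn (fun w hw =>
        hasDerivAt_div_zero (hf3 x₀ hx₀ w hw).2 (hf₃ne x₀ hx₀ w hw)
          (hl₂d.differentiableAt_partial hU ⟨hx₀, hw⟩).2
          (by rw [(hpde x₀ hx₀ w hw).2.1, e₂, sq])) hy hy₀
    set a := l₁ x₀ y₀ / f₃ x₀ y₀
    set b := l₂ x₀ y₀ / f₃ x₀ y₀
    have hx : ∀ x ∈ I₁, (f₃ x y₀)⁻¹ + a * x = (f₃ x₀ y₀)⁻¹ + a * x₀ := fun x hx =>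
      eq_of_hasDerivAt_zero (g := fun t => (f₃ t y₀)⁻¹ + a * t) hI₁open hI₁conn (fun w hw =>
        hasDerivAt_inv_add_mul_zero (hf3 w hw y₀ hy₀).1 (hf₃ne w hw y₀ hy₀)
          (by rw [e₁, hP w hw])) hx hx₀
    have hy : ∀ x ∈ I₁, ∀ y ∈ I₂, (f₃ x y)⁻¹ + b * y = (f₃ x y₀)⁻¹ + b * y₀ := fun x hx y hy =>
      eq_of_hasDerivAt_zero (g := fun t => (f₃ x t)⁻¹ + b * t) hI₂open hI₂conn (fun w hw =>
        hasDerivAt_inv_add_mul_zero (hf3 x hx w hw).2 (hf₃ne x hx w hw)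
          (by rw [e₂, hQ₁ x hx w hw, hQ₂ w hw])) hy hy₀
    have key : ∀ x ∈ I₁, ∀ y ∈ I₂,
        -a * x + -b * y + ((f₃ x₀ y₀)⁻¹ + a * x₀ + b * y₀) = (f₃ x y)⁻¹ := fun x hxI y hyI => by
      linear_combination -hx x hxI - hy x hxI y hyI
    refine ⟨-a, -b, (f₃ x₀ y₀)⁻¹ + a * x₀ + b * y₀, fun x hxI y hyI => ?_, fun x hxI y hyI => ?_⟩
    · rw [key x hxI y hyI]
      exact inv_ne_zero (hf₃ne x hxI y hyI)
    · rw [key x hxI y hyI, one_div, inv_inv]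
  · rintro ⟨⟨k, hk⟩, c₁, c₂, c₃, hL, hf3eq⟩
    have dx : ∀ k : ℝ, ∀ F : ℝ → ℝ → ℝ,
        (∀ x ∈ I₁, ∀ y ∈ I₂, F x y = k / (c₁ * x + c₂ * y + c₃)) → ∀ x ∈ I₁, ∀ y ∈ I₂,
        deriv (fun t => F t y) x = -(k * c₁) / (c₁ * x + c₂ * y + c₃) ^ 2 := by
      intro k F hF x hx y hy
      have h := hasDerivAt_div_affine k c₁ (c₂ * y + c₃) x (by
        rw [← add_assoc]; exact hL x hx y hy)
      simp only [← add_assoc] at h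
      exact (h.congr_of_eventuallyEq (by
        filter_upwards [hI₁open.mem_nhds hx] with t ht using hF t ht y hy)).deriv
    have dy : ∀ k : ℝ, ∀ F : ℝ → ℝ → ℝ,
        (∀ x ∈ I₁, ∀ y ∈ I₂, F x y = k / (c₁ * x + c₂ * y + c₃)) → ∀ x ∈ I₁, ∀ y ∈ I₂,
        deriv (fun t => F x t) y = -(k * c₂) / (c₁ * x + c₂ * y + c₃) ^ 2 := by
      intro k F hF x hx y hy
      have e : ∀ t, c₂ * t + (c₁ * x + c₃) = c₁ * x + c₂ * t + c₃ := fun t => by ring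
      have h := hasDerivAt_div_affine k c₂ (c₁ * x + c₃) y (by
        rw [e]; exact hL x hx y hy)
      simp only [e] at h
      exact (h.congr_of_eventuallyEq (by
        filter_upwards [hI₂open.mem_nhds hy] with t ht using hF x hx t ht)).deriv
    have h₁ : ∀ x ∈ I₁, ∀ y ∈ I₂, l₁ x y = -c₁ / (c₁ * x + c₂ * y + c₃) := by
      intro x hx y hy
      have := hL x hx y hy
      simp only [hl₁]
      rw [dx 1 f₃ hf3eq x hx y hy, hf3eq x hx y hy]
      field_simp
    have h₂ : ∀ x ∈ I₁, ∀ y ∈ I₂, l₂ x y = -c₂ / (c₁ * x + c₂ * y + c₃) := by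
      intro x hx y hy
      have := hL x hx y hy
      simp only [hl₂]
      rw [dy 1 f₃ hf3eq x hx y hy, hf3eq x hx y hy]
      field_simp
    refine ⟨fun z hz => ?_, fun x hx y hy => ?_⟩
    · exact ((hasDerivAt_const z k).congr_of_eventuallyEq (by
        filter_upwards [hI₃open.mem_nhds hz] with t ht using hk t ht)).deriv
    · have := hL x hx y hy
      rw [dx _ l₁ h₁ x hx y hy, dy _ l₂ h₂ x hx y hy, dx _ l₂ h₂ x hx y hy, h₁ x hx y hy,
        h₂ x hx y hy]
      refine ⟨?_, ?_, ?_⟩ <;> field_simp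
end
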